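/- Let $k \geq \ell \geq \ell' \geq t \geq 1$ and let $\omega_1, \omega_2 : \{0,\ldots,k\} \to \mathbb{R}_{\geq 0}$ be non-increasing. For non-empty cross $t$-intersecting families $\mathcal{F} \subseteq \binom{[k]}{\leq \ell}$ and $\mathcal{G} \subseteq \binom{[k]}{\leq \ell'}$, we have $\omega_1(\mathcal{F}) + \omega_2(\mathcal{G}) \leq \max\big\{\max_{a \in [t,\ell']} \{\omega_1(\mathcal{K}_k(a,\ell,t)) + \omega_2(\mathcal{S}_k(a,\ell'))\},\ \max_{a \in [t,\ell]} \{\omega_1(\mathcal{S}_k(a,\ell)) + \omega_2(\mathcal{K}_k(a,\ell',t))\}\big\}$. -/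

import Mathlib

/-- `K_k(a, l, t)`: subsets of `[k]` of size at most `l` meeting `[a]` in at least `t` elements. -/
def Kfam (k a l t : ℕ) : Finset (Finset ℕ) :=
  (Finset.Icc 1 k).powerset.filter (fun K => K.card ≤ l ∧ t ≤ (K ∩ Finset.Icc 1 a).card)

/-- `S_k(a, l)`: subsets of `[k]` of size at most `l` containing `[a]`. -/
def Sfam (k a l : ℕ) : Finset (Finset ℕ) :=
  (Finset.Icc 1 k).powerset.filter (fun S => S.card ≤ l ∧ Finset.Icc 1 a ⊆ S)

section

open Finset

/-- Every pair of members of `F` and `G` meets in at least `t` elements of `I`. -/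
def CrossOn (t : ℕ) (I : Finset ℕ) (F G : Finset (Finset ℕ)) : Prop :=
  ∀ A ∈ F, ∀ B ∈ G, t ≤ (A ∩ B ∩ I).card

lemma CrossOn.symm {t : ℕ} {I : Finset ℕ} {F G : Finset (Finset ℕ)} (h : CrossOn t I F G) :
    CrossOn t I G F := by
  intro B hB A hA
  rw [inter_comm B A]
  exact h A hA B hB

/-- The members of `F` that are moved by the shift replacing `a` by `x`. -/
def shiftMoved (x a : ℕ) (F : Finset (Finset ℕ)) : Finset (Finset ℕ) :=
  F.filter (fun A => a ∈ A ∧ x ∉ A ∧ insert x (A.erase a) ∉ F)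

/-- The shift of the family `F` replacing `a` by `x`. -/
def shiftFam (x a : ℕ) (F : Finset (Finset ℕ)) : Finset (Finset ℕ) :=
  (F \ shiftMoved x a F) ∪ (shiftMoved x a F).image (fun A => insert x (A.erase a))

lemma mem_shiftMoved {x a : ℕ} {F : Finset (Finset ℕ)} {A : Finset ℕ} :
    A ∈ shiftMoved x a F ↔ A ∈ F ∧ a ∈ A ∧ x ∉ A ∧ insert x (A.erase a) ∉ F := by
  simp [shiftMoved]

lemma shiftMoved_subset (x a : ℕ) (F : Finset (Finset ℕ)) : shiftMoved x a F ⊆ F :=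
  filter_subset _ _

lemma mem_shiftFam {x a : ℕ} {F : Finset (Finset ℕ)} {A : Finset ℕ} (hA : A ∈ shiftFam x a F) :
    (A ∈ F ∧ A ∉ shiftMoved x a F) ∨
      ∃ A₀ ∈ shiftMoved x a F, A = insert x (A₀.erase a) := by
  simp only [shiftFam, mem_union, mem_sdiff, mem_image] at hA
  rcases hA with h | ⟨A₀, h, rfl⟩
  · exact Or.inl h
  · exact Or.inr ⟨A₀, h, rfl⟩

lemma card_insert_erase {x a : ℕ} {A : Finset ℕ} (ha : a ∈ A) (hx : x ∉ A) :
    (insert x (A.erase a)).card = A.card := by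
  rw [card_insert_of_notMem (fun h => hx (mem_of_mem_erase h)), card_erase_add_one ha]

lemma card_le_card_insert_erase {x a : ℕ} {A : Finset ℕ} (hx : x ∉ A) :
    A.card ≤ (insert x (A.erase a)).card := by
  rw [card_insert_of_notMem (fun h => hx (mem_of_mem_erase h))]
  have := pred_card_le_card_erase (s := A) (a := a)
  omega

lemma sum_shiftFam (w : ℕ → ℝ) (x a : ℕ) (F : Finset (Finset ℕ)) :
    ∑ A ∈ shiftFam x a F, w A.card = ∑ A ∈ F, w A.card := by
  have hdisj : Disjoint (F \ shiftMoved x a F)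
      ((shiftMoved x a F).image (fun A => insert x (A.erase a))) := by
    rw [disjoint_right]
    intro A hA hA'
    obtain ⟨A₀, h, rfl⟩ := mem_image.mp hA
    exact (mem_shiftMoved.mp h).2.2.2 (mem_sdiff.mp hA').1
  have hinj : Set.InjOn (fun A : Finset ℕ => insert x (A.erase a))
      (shiftMoved x a F : Set (Finset ℕ)) := by
    intro A hA B hB hAB
    obtain ⟨-, haA, hxA, -⟩ := mem_shiftMoved.mp hA
    obtain ⟨-, haB, hxB, -⟩ := mem_shiftMoved.mp hB
    ext y
    have := Finset.ext_iff.mp hAB y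
    simp only [mem_insert, mem_erase] at this
    grind
  rw [shiftFam, sum_union hdisj, sum_image hinj,
    ← sum_sdiff (shiftMoved_subset x a F)]
  congr 1
  refine sum_congr rfl fun A hA => ?_
  obtain ⟨-, ha, hx, -⟩ := mem_shiftMoved.mp hA
  rw [card_insert_erase ha hx]

lemma shiftFam_nonempty {x a : ℕ} {F : Finset (Finset ℕ)} (hF : F.Nonempty) :
    (shiftFam x a F).Nonempty := by
  obtain ⟨A, hA⟩ := hF
  by_cases h : A ∈ shiftMoved x a F
  · exact ⟨_, mem_union_right _ (mem_image_of_mem _ h)⟩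
  · exact ⟨A, mem_union_left _ (mem_sdiff.mpr ⟨hA, h⟩)⟩

lemma shiftFam_bounded {x a k l : ℕ} {F : Finset (Finset ℕ)} (hx : x ∈ Icc 1 k)
    (hF : ∀ A ∈ F, A ⊆ Icc 1 k ∧ A.card ≤ l) :
    ∀ A ∈ shiftFam x a F, A ⊆ Icc 1 k ∧ A.card ≤ l := by
  intro A hA
  rcases mem_shiftFam hA with ⟨h, -⟩ | ⟨A₀, h, rfl⟩
  · exact hF A h
  · obtain ⟨h, ha, hxA, -⟩ := mem_shiftMoved.mp h
    refine ⟨insert_subset hx ((erase_subset _ _).trans (hF _ h).1), ?_⟩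
    rw [card_insert_erase ha hxA]
    exact (hF _ h).2

lemma filter_shiftFam_subset {x a : ℕ} (hxa : x ≠ a) (F : Finset (Finset ℕ)) :
    (shiftFam x a F).filter (a ∈ ·) ⊆ F.filter (a ∈ ·) \ shiftMoved x a F := by
  intro A hA
  obtain ⟨hA, ha⟩ := mem_filter.mp hA
  rcases mem_shiftFam hA with ⟨h, h'⟩ | ⟨A₀, h, rfl⟩
  · exact mem_sdiff.mpr ⟨mem_filter.mpr ⟨h, ha⟩, h'⟩
  · simp [hxa.symm] at ha

lemma card_filter_shiftFam_le {x a : ℕ} (hxa : x ≠ a) (F : Finset (Finset ℕ)) :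
    ((shiftFam x a F).filter (a ∈ ·)).card ≤ (F.filter (a ∈ ·)).card :=
  card_le_card ((filter_shiftFam_subset hxa F).trans sdiff_subset)

lemma card_filter_shiftFam_lt {x a : ℕ} (hxa : x ≠ a) {F : Finset (Finset ℕ)}
    (h : (shiftMoved x a F).Nonempty) :
    ((shiftFam x a F).filter (a ∈ ·)).card < (F.filter (a ∈ ·)).card := by
  obtain ⟨A, hA⟩ := h
  refine card_lt_card ((ssubset_iff_of_subset
    ((filter_shiftFam_subset hxa F).trans sdiff_subset)).mpr ⟨A, ?_, fun h => ?_⟩)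
  · obtain ⟨h, ha, -⟩ := mem_shiftMoved.mp hA
    exact mem_filter.mpr ⟨h, ha⟩
  · exact (mem_sdiff.mp (filter_shiftFam_subset hxa F h)).2 hA

lemma le_card_inter_of_moved {t x a : ℕ} {I : Finset ℕ} {F G : Finset (Finset ℕ)}
    (hx : x ∈ I) (h : CrossOn t I F G) {A B : Finset ℕ}
    (hA : A ∈ shiftMoved x a F) (hB : B ∈ G) (hB' : B ∉ shiftMoved x a G) :
    t ≤ (insert x (A.erase a) ∩ B ∩ I).card := by
  obtain ⟨hAF, haA, hxA, -⟩ := mem_shiftMoved.mp hA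
  by_cases haB : a ∈ B
  · by_cases hxB : x ∈ B
    · have heq : insert x (A.erase a) ∩ B ∩ I = insert x ((A ∩ B ∩ I).erase a) := by
        ext y; simp only [mem_inter, mem_insert, mem_erase]; grind
      rw [heq]
      exact (h A hAF B hB).trans (card_le_card_insert_erase (by simp [hxA]))
    · have hBG : insert x (B.erase a) ∈ G := by
        by_contra hn
        exact hB' (mem_shiftMoved.mpr ⟨hB, haB, hxB, hn⟩)
      refine (h A hAF _ hBG).trans (card_le_card ?_)
      intro y; simp only [mem_inter, mem_insert, mem_erase]; grind
  · refine (h A hAF B hB).trans (card_le_card ?_)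
    intro y; simp only [mem_inter, mem_insert, mem_erase]; grind

lemma CrossOn.shiftFam {t x a : ℕ} {I : Finset ℕ} {F G : Finset (Finset ℕ)}
    (hx : x ∈ I) (h : CrossOn t I F G) : CrossOn t I (shiftFam x a F) (shiftFam x a G) := by
  intro A hA B hB
  rcases mem_shiftFam hA with ⟨hA, hA'⟩ | ⟨A₀, hA₀, rfl⟩ <;>
    rcases mem_shiftFam hB with ⟨hB, hB'⟩ | ⟨B₀, hB₀, rfl⟩
  · exact h A hA B hB
  · rw [inter_comm A]
    exact le_card_inter_of_moved hx h.symm hB₀ hA hA'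
  · exact le_card_inter_of_moved hx h hA₀ hB hB'
  · obtain ⟨hAF, haA, hxA, -⟩ := mem_shiftMoved.mp hA₀
    obtain ⟨hBG, haB, hxB, -⟩ := mem_shiftMoved.mp hB₀
    have heq : insert x (A₀.erase a) ∩ insert x (B₀.erase a) ∩ I =
        insert x ((A₀ ∩ B₀ ∩ I).erase a) := by
      ext y; simp only [mem_inter, mem_insert, mem_erase]; grind
    rw [heq]
    exact (h _ hAF _ hBG).trans (card_le_card_insert_erase (by simp [hxA]))

/-- The members `A` of `F` containing `a`, with `i` elements in `I`, and with `A \ {a} ∉ F`. -/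
def erasable (a i : ℕ) (I : Finset ℕ) (F : Finset (Finset ℕ)) : Finset (Finset ℕ) :=
  F.filter (fun A => a ∈ A ∧ (A ∩ I).card = i ∧ A.erase a ∉ F)

lemma mem_erasable {a i : ℕ} {I : Finset ℕ} {F : Finset (Finset ℕ)} {A : Finset ℕ} :
    A ∈ erasable a i I F ↔ A ∈ F ∧ a ∈ A ∧ (A ∩ I).card = i ∧ A.erase a ∉ F := by
  simp [erasable]

lemma erasable_subset (a i : ℕ) (I : Finset ℕ) (F : Finset (Finset ℕ)) : erasable a i I F ⊆ F :=
  filter_subset _ _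

/-- The family `F` together with the sets `A \ {a}` for its erasable members `A`. -/
def augment (a i : ℕ) (I : Finset ℕ) (F : Finset (Finset ℕ)) : Finset (Finset ℕ) :=
  F ∪ (erasable a i I F).image (fun A => A.erase a)

lemma sum_augment_ge {k l : ℕ} (hlk : l ≤ k) (w : ℕ → ℝ)
    (hw : ∀ i j, i ≤ j → j ≤ k → w j ≤ w i) (a i : ℕ) (I : Finset ℕ)
    {F : Finset (Finset ℕ)} (hF : ∀ A ∈ F, A ⊆ Icc 1 k ∧ A.card ≤ l) :
    ∑ A ∈ F, w A.card + ∑ A ∈ erasable a i I F, w A.card ≤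
      ∑ A ∈ augment a i I F, w A.card := by
  have hdisj : Disjoint F ((erasable a i I F).image (fun A => A.erase a)) := by
    rw [disjoint_right]
    intro A hA
    obtain ⟨A₀, h, rfl⟩ := mem_image.mp hA
    exact (mem_erasable.mp h).2.2.2
  have hinj : Set.InjOn (fun A : Finset ℕ => A.erase a)
      (erasable a i I F : Set (Finset ℕ)) := by
    intro A hA B hB hAB
    rw [← insert_erase (mem_erasable.mp hA).2.1, ← insert_erase (mem_erasable.mp hB).2.1]
    exact congrArg (insert a) hAB
  rw [augment, sum_union hdisj, sum_image hinj]
  refine add_le_add_right (sum_le_sum fun A hA => ?_) _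
  exact hw _ _ (card_le_card (erase_subset _ _)) ((hF A (mem_erasable.mp hA).1).2.trans hlk)

lemma augment_bounded {k l a i : ℕ} {I : Finset ℕ} {F : Finset (Finset ℕ)}
    (hF : ∀ A ∈ F, A ⊆ Icc 1 k ∧ A.card ≤ l) :
    ∀ A ∈ augment a i I F, A ⊆ Icc 1 k ∧ A.card ≤ l := by
  intro A hA
  rcases mem_union.mp hA with h | h
  · exact hF A h
  · obtain ⟨A₀, hA₀, rfl⟩ := mem_image.mp h
    have := hF A₀ (mem_erasable.mp hA₀).1
    exact ⟨(erase_subset _ _).trans this.1, (card_le_card (erase_subset _ _)).trans this.2⟩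

lemma filter_augment_subset (a i : ℕ) (I : Finset ℕ) (F : Finset (Finset ℕ)) :
    (augment a i I F).filter (a ∈ ·) ⊆ F.filter (a ∈ ·) := by
  intro A hA
  obtain ⟨hA, ha⟩ := mem_filter.mp hA
  rcases mem_union.mp hA with h | h
  · exact mem_filter.mpr ⟨h, ha⟩
  · obtain ⟨A₀, -, rfl⟩ := mem_image.mp h
    simp at ha

lemma card_filter_sdiff_erasable_lt {a j : ℕ} {I : Finset ℕ} {G : Finset (Finset ℕ)}
    (h : (erasable a j I G).Nonempty) :
    ((G \ erasable a j I G).filter (a ∈ ·)).card < (G.filter (a ∈ ·)).card := by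
  obtain ⟨B, hB⟩ := h
  refine card_lt_card ((ssubset_iff_of_subset (filter_subset_filter _ sdiff_subset)).mpr
    ⟨B, ?_, fun h => ?_⟩)
  · exact mem_filter.mpr ⟨(mem_erasable.mp hB).1, (mem_erasable.mp hB).2.1⟩
  · exact (mem_sdiff.mp (mem_filter.mp h).1).2 hB

lemma card_inter_erase_lt {a t : ℕ} {I A B : Finset ℕ} (haI : a ∈ I) (haA : a ∈ A) (haB : a ∈ B)
    (h : (A ∩ B ∩ I).card = t) : (A.erase a ∩ B ∩ I).card < t := by
  rw [← h]
  refine card_lt_card ((ssubset_iff_of_subset (by gcongr; exact erase_subset _ _)).mpr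
    ⟨a, by simp [haI, haA, haB], by simp⟩)

lemma mem_erasable_of_card_eq {t a j : ℕ} {I A B : Finset ℕ} {F G : Finset (Finset ℕ)}
    (haI : a ∈ I) (h : CrossOn t I F G) (hA : A ∈ F) (hB : B ∈ G) (haA : a ∈ A) (haB : a ∈ B)
    (hAB : (A ∩ B ∩ I).card = t) (hj : (B ∩ I).card = j) : B ∈ erasable a j I G := by
  refine mem_erasable.mpr ⟨hB, haB, hj, fun hn => ?_⟩
  have h₁ := h.symm _ hn _ hA
  have h₂ := card_inter_erase_lt haI haB haA (inter_comm A B ▸ hAB)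
  omega

lemma CrossOn.augment {t a i j : ℕ} {I : Finset ℕ} {F G : Finset (Finset ℕ)} (haI : a ∈ I)
    (h : CrossOn t I F G) (hij : i + j = I.card + t)
    (htight : ∀ A ∈ F, ∀ B ∈ G, a ∈ A → a ∈ B → (A ∩ B ∩ I).card = t →
      (A ∩ I).card + (B ∩ I).card = I.card + t) :
    CrossOn t I (augment a i I F) (G \ erasable a j I G) := by
  intro A hA B hB
  obtain ⟨hB, hB'⟩ := mem_sdiff.mp hB
  rcases mem_union.mp hA with hA | hA
  · exact h A hA B hB
  obtain ⟨A, hAe, rfl⟩ := mem_image.mp hA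
  obtain ⟨hA, haA, hi, -⟩ := mem_erasable.mp hAe
  by_cases haB : a ∈ B
  · have hle := h A hA B hB
    rcases hle.eq_or_lt with heq | hlt
    · have := htight A hA B hB haA haB heq.symm
      exact absurd (mem_erasable_of_card_eq haI h hA hB haA haB heq.symm (by omega)) hB'
    · have heq : A.erase a ∩ B ∩ I = (A ∩ B ∩ I).erase a := by
        ext y; simp only [mem_inter, mem_erase]; tauto
      have := pred_card_le_card_erase (s := A ∩ B ∩ I) (a := a)
      rw [heq]
      omega
  · refine (h A hA B hB).trans (card_le_card ?_)
    intro y; simp only [mem_inter, mem_erase]; grind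

lemma subset_of_shiftMoved_eq_empty {a : ℕ} {I : Finset ℕ} {G : Finset (Finset ℕ)}
    (hstable : ∀ x ∈ I, x ≠ a → shiftMoved x a G = ∅) (hall : ∀ B ∈ G, a ∈ B) :
    ∀ B ∈ G, I ⊆ B := by
  intro B hB x hx
  by_contra hxB
  have hxa : x ≠ a := by rintro rfl; exact hxB (hall B hB)
  by_cases h : insert x (B.erase a) ∈ G
  · have := hall _ h
    simp [hxa.symm] at this
  · have := mem_shiftMoved.mpr ⟨hB, hall B hB, hxB, h⟩
    simp [hstable x hx hxa] at this

lemma card_add_card_of_tight {t a : ℕ} {I A B : Finset ℕ} {F G : Finset (Finset ℕ)}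
    (haI : a ∈ I) (h : CrossOn t I F G)
    (hstable : ∀ x ∈ I, x ≠ a → shiftMoved x a F = ∅) (hA : A ∈ F) (hB : B ∈ G)
    (haA : a ∈ A) (haB : a ∈ B) (hAB : (A ∩ B ∩ I).card = t) :
    (A ∩ I).card + (B ∩ I).card = I.card + t := by
  have hcover : A ∩ I ∪ B ∩ I = I := by
    refine subset_antisymm (union_subset inter_subset_right inter_subset_right) fun x hx => ?_
    by_contra hn
    have hxA : x ∉ A := fun h => hn (by simp [h, hx])
    have hxB : x ∉ B := fun h => hn (by simp [h, hx])
    have hxa : x ≠ a := by rintro rfl; exact hxA haA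
    by_cases hm : insert x (A.erase a) ∈ F
    · have h₁ := h _ hm _ hB
      have h₂ := card_inter_erase_lt haI haA haB hAB
      have heq : insert x (A.erase a) ∩ B ∩ I = A.erase a ∩ B ∩ I := by
        rw [insert_inter_of_notMem hxB]
      rw [heq] at h₁
      omega
    · have := mem_shiftMoved.mpr ⟨hA, haA, hxA, hm⟩
      simp [hstable x hx hxa] at this
  have hinter : A ∩ I ∩ (B ∩ I) = A ∩ B ∩ I := by
    rw [← inter_inter_distrib_right]
  rw [← card_union_add_card_inter, hcover, hinter, hAB]

lemma sum_le_of_forall_subset {k a t l l' : ℕ} {w1 w2 : ℕ → ℝ}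
    (hw1 : ∀ i, 0 ≤ w1 i) (hw2 : ∀ i, 0 ≤ w2 i) {F G : Finset (Finset ℕ)}
    (hF : ∀ A ∈ F, A ⊆ Icc 1 k ∧ A.card ≤ l) (hG : ∀ B ∈ G, B ⊆ Icc 1 k ∧ B.card ≤ l')
    (hGne : G.Nonempty) (h : CrossOn t (Icc 1 a) F G) (hsub : ∀ B ∈ G, Icc 1 a ⊆ B) :
    ∑ A ∈ F, w1 A.card + ∑ B ∈ G, w2 B.card ≤
      ∑ K ∈ Kfam k a l t, w1 K.card + ∑ S ∈ Sfam k a l', w2 S.card := by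
  obtain ⟨B, hB⟩ := hGne
  refine add_le_add (sum_le_sum_of_subset_of_nonneg (fun A hA => ?_) fun _ _ _ => hw1 _)
    (sum_le_sum_of_subset_of_nonneg (fun B hB => ?_) fun _ _ _ => hw2 _)
  · refine mem_filter.mpr ⟨mem_powerset.mpr (hF A hA).1, (hF A hA).2,
      (h A hA B hB).trans (card_le_card ?_)⟩
    gcongr
    exact inter_subset_left
  · exact mem_filter.mpr ⟨mem_powerset.mpr (hG B hB).1, (hG B hB).2, hsub B hB⟩

lemma sdiff_erasable_nonempty {a j : ℕ} {I : Finset ℕ} {G : Finset (Finset ℕ)}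
    (h : ¬ ∀ B ∈ G, a ∈ B) : (G \ erasable a j I G).Nonempty := by
  push Not at h
  obtain ⟨B, hB, ha⟩ := h
  exact ⟨B, mem_sdiff.mpr ⟨hB, fun hn => ha (mem_erasable.mp hn).2.1⟩⟩

lemma CrossOn.of_forall_card_ne {t a : ℕ} {F G : Finset (Finset ℕ)}
    (h : CrossOn t (Icc 1 (a + 1)) F G)
    (hne : ∀ A ∈ F, ∀ B ∈ G, a + 1 ∈ A → a + 1 ∈ B → (A ∩ B ∩ Icc 1 (a + 1)).card ≠ t) :
    CrossOn t (Icc 1 a) F G := by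
  intro A hA B hB
  have hle := h A hA B hB
  have heq : A ∩ B ∩ Icc 1 a = (A ∩ B ∩ Icc 1 (a + 1)).erase (a + 1) := by
    ext y; simp only [mem_inter, mem_erase, mem_Icc]; grind
  rw [heq]
  by_cases hmem : a + 1 ∈ A ∧ a + 1 ∈ B
  · have := hne A hA B hB hmem.1 hmem.2
    have := pred_card_le_card_erase (s := A ∩ B ∩ Icc 1 (a + 1)) (a := a + 1)
    omega
  · rwa [erase_eq_of_notMem (by simp only [mem_inter]; tauto)]

lemma sum_le_of_crossOn {k l l' t : ℕ} (hlk : l ≤ k) (hlk' : l' ≤ k) (ht : 1 ≤ t)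
    {w1 w2 : ℕ → ℝ} (hw1pos : ∀ i, 0 ≤ w1 i) (hw2pos : ∀ i, 0 ≤ w2 i)
    (hw1mono : ∀ i j, i ≤ j → j ≤ k → w1 j ≤ w1 i)
    (hw2mono : ∀ i j, i ≤ j → j ≤ k → w2 j ≤ w2 i) {M : ℝ}
    (hM : ∀ a ∈ Icc t l',
      ∑ K ∈ Kfam k a l t, w1 K.card + ∑ S ∈ Sfam k a l', w2 S.card ≤ M)
    (hM' : ∀ a ∈ Icc t l,
      ∑ S ∈ Sfam k a l, w1 S.card + ∑ K ∈ Kfam k a l' t, w2 K.card ≤ M)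
    {a : ℕ} (hak : a ≤ k) {F G : Finset (Finset ℕ)}
    (hF : ∀ A ∈ F, A ⊆ Icc 1 k ∧ A.card ≤ l) (hG : ∀ B ∈ G, B ⊆ Icc 1 k ∧ B.card ≤ l')
    (hFne : F.Nonempty) (hGne : G.Nonempty) (h : CrossOn t (Icc 1 a) F G) :
    ∑ A ∈ F, w1 A.card + ∑ B ∈ G, w2 B.card ≤ M := by
  induction a generalizing F G with
  | zero =>
    obtain ⟨A, hA⟩ := hFne
    obtain ⟨B, hB⟩ := hGne
    have := h A hA B hB
    simp at this
    omega
  | succ a iha =>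
    induction hN : (F.filter (a + 1 ∈ ·)).card + (G.filter (a + 1 ∈ ·)).card
      using Nat.strong_induction_on generalizing F G with
    | _ N ihN =>
    subst hN
    have haI : a + 1 ∈ Icc 1 (a + 1) := by simp
    by_cases hst : ∀ x ∈ Icc 1 (a + 1), x ≠ a + 1 →
        shiftMoved x (a + 1) F = ∅ ∧ shiftMoved x (a + 1) G = ∅
    swap
    · push Not at hst
      obtain ⟨x, hx, hxa, hmoved⟩ := hst
      have hxk : x ∈ Icc 1 k := Icc_subset_Icc_right hak hx
      rw [← sum_shiftFam w1 x (a + 1) F, ← sum_shiftFam w2 x (a + 1) G]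
      refine ihN _ ?_ (shiftFam_bounded hxk hF) (shiftFam_bounded hxk hG)
        (shiftFam_nonempty hFne) (shiftFam_nonempty hGne) (h.shiftFam hx) rfl
      have h₁ := card_filter_shiftFam_le hxa F
      have h₂ := card_filter_shiftFam_le hxa G
      rcases (shiftMoved x (a + 1) F).eq_empty_or_nonempty with he | hne
      · have := card_filter_shiftFam_lt hxa (hmoved he)
        omega
      · have := card_filter_shiftFam_lt hxa hne
        omega
    have hstF := fun x hx hxa => (hst x hx hxa).1
    have hstG := fun x hx hxa => (hst x hx hxa).2
    have hta : t ≤ a + 1 := by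
      obtain ⟨A, hA⟩ := hFne
      obtain ⟨B, hB⟩ := hGne
      simpa using (h A hA B hB).trans (card_le_card inter_subset_right)
    by_cases hallG : ∀ B ∈ G, a + 1 ∈ B
    · have hsub := subset_of_shiftMoved_eq_empty hstG hallG
      refine (sum_le_of_forall_subset hw1pos hw2pos hF hG hGne h hsub).trans
        (hM _ (mem_Icc.mpr ⟨hta, ?_⟩))
      obtain ⟨B, hB⟩ := hGne
      simpa using (card_le_card (hsub B hB)).trans (hG B hB).2
    by_cases hallF : ∀ A ∈ F, a + 1 ∈ A
    · have hsub := subset_of_shiftMoved_eq_empty hstF hallF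
      rw [add_comm]
      refine (sum_le_of_forall_subset hw2pos hw1pos hG hF hFne h.symm hsub).trans
        ((add_comm _ _).trans_le (hM' _ (mem_Icc.mpr ⟨hta, ?_⟩)))
      obtain ⟨A, hA⟩ := hFne
      simpa using (card_le_card (hsub A hA)).trans (hF A hA).2
    by_cases hcrit : ∀ A ∈ F, ∀ B ∈ G, a + 1 ∈ A → a + 1 ∈ B →
        (A ∩ B ∩ Icc 1 (a + 1)).card ≠ t
    · exact iha (by omega) hF hG hFne hGne (h.of_forall_card_ne hcrit)
    push Not at hcrit
    obtain ⟨A, hA, B, hB, haA, haB, hAB⟩ := hcrit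
    have htight : ∀ A ∈ F, ∀ B ∈ G, a + 1 ∈ A → a + 1 ∈ B → (A ∩ B ∩ Icc 1 (a + 1)).card = t →
        (A ∩ Icc 1 (a + 1)).card + (B ∩ Icc 1 (a + 1)).card = (Icc 1 (a + 1)).card + t :=
      fun A hA B hB => card_add_card_of_tight haI h hstF hA hB
    have htight' : ∀ B ∈ G, ∀ A ∈ F, a + 1 ∈ B → a + 1 ∈ A → (B ∩ A ∩ Icc 1 (a + 1)).card = t →
        (B ∩ Icc 1 (a + 1)).card + (A ∩ Icc 1 (a + 1)).card = (Icc 1 (a + 1)).card + t :=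
      fun B hB A hA => card_add_card_of_tight haI h.symm hstG hB hA
    have hij := htight A hA B hB haA haB hAB
    have hBe := mem_erasable_of_card_eq haI h hA hB haA haB hAB rfl
    have hAe := mem_erasable_of_card_eq haI h.symm hB hA haB haA (inter_comm A B ▸ hAB) rfl
    set I := Icc 1 (a + 1)
    set i := (A ∩ I).card
    set j := (B ∩ I).card
    have hltF := card_filter_sdiff_erasable_lt ⟨A, hAe⟩
    have hltG := card_filter_sdiff_erasable_lt ⟨B, hBe⟩
    have hleF := card_le_card (filter_augment_subset (a + 1) i I F)
    have hleG := card_le_card (filter_augment_subset (a + 1) j I G)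
    have hsF := sum_augment_ge hlk w1 hw1mono (a + 1) i I hF
    have hsG := sum_augment_ge hlk' w2 hw2mono (a + 1) j I hG
    have hdF := sum_sdiff (f := fun A => w1 A.card)
      (erasable_subset (a + 1) i I F)
    have hdG := sum_sdiff (f := fun A => w2 A.card)
      (erasable_subset (a + 1) j I G)
    rcases le_total (∑ B ∈ erasable (a + 1) j I G, w2 B.card)
      (∑ A ∈ erasable (a + 1) i I F, w1 A.card) with hle | hle
    · have := ihN _ (by omega) (augment_bounded hF) (fun B hB => hG B (mem_sdiff.mp hB).1)
        (hFne.mono subset_union_left) (sdiff_erasable_nonempty hallG)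
        (h.augment haI hij htight) rfl
      linarith
    · have := ihN _ (by omega) (fun A hA => hF A (mem_sdiff.mp hA).1) (augment_bounded hG)
        (sdiff_erasable_nonempty hallF) (hGne.mono subset_union_left)
        (h.symm.augment haI ((add_comm _ _).trans hij) htight').symm rfl
      linarith

end

theorem necessary_intersection_point_theorem (k l l' t : ℕ)
    (hkl : l ≤ k) (hll : l' ≤ l) (htl : t ≤ l') (ht : 1 ≤ t)
    (w1 w2 : ℕ → ℝ)
    (hw1pos : ∀ i, 0 ≤ w1 i) (hw2pos : ∀ i, 0 ≤ w2 i)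
    (hw1mono : ∀ i j, i ≤ j → j ≤ k → w1 j ≤ w1 i)
    (hw2mono : ∀ i j, i ≤ j → j ≤ k → w2 j ≤ w2 i)
    (F G : Finset (Finset ℕ))
    (hF : ∀ A ∈ F, A ⊆ Finset.Icc 1 k ∧ A.card ≤ l)
    (hG : ∀ B ∈ G, B ⊆ Finset.Icc 1 k ∧ B.card ≤ l')
    (hFne : F.Nonempty) (hGne : G.Nonempty)
    (hcross : ∀ A ∈ F, ∀ B ∈ G, t ≤ (A ∩ B).card) :
    (∑ A ∈ F, w1 A.card) + (∑ B ∈ G, w2 B.card) ≤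
      max
        ((Finset.Icc t l').sup' (Finset.nonempty_Icc.mpr htl)
          (fun a => (∑ K ∈ Kfam k a l t, w1 K.card) + (∑ S ∈ Sfam k a l', w2 S.card)))
        ((Finset.Icc t l).sup' (Finset.nonempty_Icc.mpr (le_trans htl hll))
          (fun a => (∑ S ∈ Sfam k a l, w1 S.card) + (∑ K ∈ Kfam k a l' t, w2 K.card))) := by
  refine sum_le_of_crossOn hkl (hll.trans hkl) ht hw1pos hw2pos hw1mono hw2mono
    (fun a ha => le_max_of_le_left ?_) (fun a ha => le_max_of_le_right ?_) le_rfl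
    hF hG hFne hGne ?_
  · exact Finset.le_sup' (fun a => (∑ K ∈ Kfam k a l t, w1 K.card) +
      (∑ S ∈ Sfam k a l', w2 S.card)) ha
  · exact Finset.le_sup' (fun a => (∑ S ∈ Sfam k a l, w1 S.card) +
      (∑ K ∈ Kfam k a l' t, w2 K.card)) ha
  · intro A hA B hB
    rw [Finset.inter_eq_left.mpr (Finset.inter_subset_left.trans (hF A hA).1)]
    exact hcross A hA B hB
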